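/- arXiv:2004.09035 — 9 statements merged into one kernel-verified Lean document; each statement's English description precedes it below -/
import Mathlib

section
/- For any nonnegative integers t₁, t₂ not both zero and any positive rational number ν, there exist integers m ≥ 1, n ≥ 1, l ≥ 0 with m·n − l² ≥ 1 such that (n·t₁² + m·t₂² − 2·l·t₁·t₂)/(m·n − l²) = ν. Equivalently, A_{t₁,t₂} equals the set of all positive rationals. -/
/-- The matrix `K = (t tᵀ + c w wᵀ) / ν` with `ν = p / q`, `w = t + p e₁`, `c = q (2 p - 1)` is
integral and positive definite when `t₂ > 0`, and has filling fraction `ν`. -/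
lemma exists_filling_of_pos_right (t₁ t₂ : ℤ) (ht₁ : 0 ≤ t₁) (ht₂ : 0 < t₂) (ν : ℚ)
    (hν : 0 < ν) :
    ∃ m n l : ℤ, 1 ≤ m ∧ 1 ≤ n ∧ 0 ≤ l ∧ 1 ≤ m * n - l ^ 2 ∧
      ((n : ℚ) * t₁ ^ 2 + (m : ℚ) * t₂ ^ 2 - 2 * l * t₁ * t₂) / ((m : ℚ) * n - (l : ℚ) ^ 2)
        = ν := by
  obtain ⟨p, q, hp, hq, rfl⟩ : ∃ p q : ℤ, 0 < p ∧ 0 < q ∧ ν = p / q :=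
    ⟨ν.num, ν.den, Rat.num_pos.mpr hν, mod_cast ν.den_pos, by simp [Rat.num_div_den]⟩
  obtain ⟨c, hc⟩ : ∃ c, c = q * (2 * p - 1) := ⟨_, rfl⟩
  have hc_pos : 0 < c := hc ▸ mul_pos hq (by linarith)
  have hdet : (2 * q * t₁ ^ 2 + c * (2 * t₁ + p)) * (2 * q * t₂ ^ 2)
      - (2 * q * t₁ * t₂ + c * t₂) ^ 2 = q * c * t₂ ^ 2 := by
    subst hc; ring
  refine ⟨2 * q * t₁ ^ 2 + c * (2 * t₁ + p), 2 * q * t₂ ^ 2, 2 * q * t₁ * t₂ + c * t₂,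
    Order.one_le_iff_pos.mpr (by positivity), Order.one_le_iff_pos.mpr (by positivity), by positivity,
    hdet ▸ Order.one_le_iff_pos.mpr (by positivity), ?_⟩
  have hdet_cast := congrArg (Int.cast : ℤ → ℚ) hdet
  push_cast at hdet_cast ⊢
  rw [hdet_cast]
  have hq' : (q : ℚ) ≠ 0 := mod_cast hq.ne'
  have hc' : (c : ℚ) ≠ 0 := mod_cast hc_pos.ne'
  have ht' : (t₂ : ℚ) ≠ 0 := mod_cast ht₂.ne'
  field_simp
  ring


/-- For any nonnegative integers `t₁, t₂` not both zero and any positive rational `ν`,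
there exist integers `m ≥ 1`, `n ≥ 1`, `l ≥ 0` with `m*n - l^2 ≥ 1` such that
`(n*t₁² + m*t₂² - 2*l*t₁*t₂)/(m*n - l²) = ν`. -/
theorem halperin_any_filling (t₁ t₂ : ℤ) (ht₁ : 0 ≤ t₁) (ht₂ : 0 ≤ t₂)
    (ht : ¬ (t₁ = 0 ∧ t₂ = 0)) (ν : ℚ) (hν : 0 < ν) :
    ∃ m n l : ℤ, 1 ≤ m ∧ 1 ≤ n ∧ 0 ≤ l ∧ 1 ≤ m * n - l ^ 2 ∧
      ((n : ℚ) * t₁ ^ 2 + (m : ℚ) * t₂ ^ 2 - 2 * l * t₁ * t₂) / ((m : ℚ) * n - (l : ℚ) ^ 2)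
        = ν := by
  rcases ht₂.lt_or_eq with h₂ | rfl
  · exact exists_filling_of_pos_right t₁ t₂ ht₁ h₂ ν hν
  · have h₁ : 0 < t₁ := lt_of_le_of_ne ht₁ fun h => ht ⟨h.symm, rfl⟩
    obtain ⟨m, n, l, hm, hn, hl, hdet, h⟩ :=
      exists_filling_of_pos_right 0 t₁ le_rfl h₁ ν hν
    refine ⟨n, m, l, hn, hm, hl, by rwa [mul_comm], ?_⟩
    rw [← h]
    push_cast
    ring
end

section
/- For any nonnegative integers t₁, t₂ not both zero, any positive rational number ν, and any real C > 0, there exist integers m ≥ 1, n ≥ 1, l ≥ 0 with m·n − l² > C such that (n·t₁² + m·t₂² − 2·l·t₁·t₂)/(m·n − l²) = ν; hence the set of determinants m·n − l² over all solutions producing ν is unbounded and the set of solutions is infinite. -/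
/-- Adding a positive rank-one form `k • v vᵀ` to `ν⁻¹ • t tᵀ` (with `ν = p / q`) yields an integral
form producing `ν`, whose determinant grows linearly in `k`. -/
theorem exists_int_form_of_filling (t₁ t₂ p q N : ℤ) (ht₁ : 0 ≤ t₁) (ht₂ : 0 ≤ t₂)
    (ht : ¬ (t₁ = 0 ∧ t₂ = 0)) (hp : 1 ≤ p) (hq : 1 ≤ q) (hN : 1 ≤ N) :
    ∃ m n l : ℤ, 1 ≤ m ∧ 1 ≤ n ∧ 0 ≤ l ∧ N ≤ m * n - l ^ 2 ∧
      q * (n * t₁ ^ 2 + m * t₂ ^ 2 - 2 * l * t₁ * t₂) = p * (m * n - l ^ 2) := by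
  obtain ⟨b, hb, hd⟩ : ∃ b : ℤ, 1 ≤ b ∧ t₁ * b - t₂ ≠ 0 := by
    by_cases h : t₁ = t₂
    · exact ⟨2, by norm_num, by omega⟩
    · exact ⟨1, le_rfl, by omega⟩
  have hk : N ≤ p * (q + N) - q := by nlinarith
  generalize hK : q + N = K at hk
  have hk0 : 0 < p * K - q := by linarith
  have hx : 0 < t₁ + p := by linarith
  have hy : 0 < t₂ + p * b := by nlinarith
  have hdet : (K * (t₁ + p) ^ 2 - q * (2 * t₁ + p)) *
      (K * (t₂ + p * b) ^ 2 - q * (2 * t₂ * b + p * b ^ 2)) -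
      (K * (t₁ + p) * (t₂ + p * b) - q * (t₁ * b + t₂ + p * b)) ^ 2 =
      q * (p * K - q) * (t₁ * b - t₂) ^ 2 := by ring
  refine ⟨K * (t₁ + p) ^ 2 - q * (2 * t₁ + p),
    K * (t₂ + p * b) ^ 2 - q * (2 * t₂ * b + p * b ^ 2),
    K * (t₁ + p) * (t₂ + p * b) - q * (t₁ * b + t₂ + p * b), ?_, ?_, ?_, ?_, by ring⟩
  · refine pos_of_mul_pos_right (a := p) ?_ (by linarith)
    calc 0 < q * t₁ ^ 2 + (p * K - q) * (t₁ + p) ^ 2 := by positivity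
      _ = _ := by ring
  · refine pos_of_mul_pos_right (a := p) ?_ (by linarith)
    calc 0 < q * t₂ ^ 2 + (p * K - q) * (t₂ + p * b) ^ 2 := by positivity
      _ = _ := by ring
  · refine nonneg_of_mul_nonneg_right (a := p) ?_ (by linarith)
    calc 0 ≤ q * (t₁ * t₂) + (p * K - q) * ((t₁ + p) * (t₂ + p * b)) := by positivity
      _ = _ := by ring
  · rw [hdet]
    have hd2 : 1 ≤ (t₁ * b - t₂) ^ 2 := by
      have : 0 < (t₁ * b - t₂) ^ 2 := by positivity
      omega
    calc N ≤ p * K - q := hk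
      _ ≤ q * (p * K - q) := le_mul_of_one_le_left hk0.le hq
      _ ≤ q * (p * K - q) * (t₁ * b - t₂) ^ 2 :=
        le_mul_of_one_le_right (by positivity) hd2


/-- For any nonnegative integers `t₁, t₂` not both zero, any positive rational `ν`, and any
real `C > 0`, there is a solution `(m, n, l)` producing `ν` with determinant `m*n - l² > C`;
hence the determinant set is unbounded and the solution set is infinite. -/
theorem halperin_unbounded_determinants (t₁ t₂ : ℤ) (ht₁ : 0 ≤ t₁) (ht₂ : 0 ≤ t₂)
    (ht : ¬ (t₁ = 0 ∧ t₂ = 0)) (ν : ℚ) (hν : 0 < ν) :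
    (∀ C : ℝ, 0 < C → ∃ m n l : ℤ, 1 ≤ m ∧ 1 ≤ n ∧ 0 ≤ l ∧ ((m * n - l ^ 2 : ℤ) : ℝ) > C ∧
        ((n : ℚ) * t₁ ^ 2 + (m : ℚ) * t₂ ^ 2 - 2 * l * t₁ * t₂) / ((m : ℚ) * n - (l : ℚ) ^ 2)
          = ν) ∧
    ¬ BddAbove {d : ℤ | ∃ m n l : ℤ, 1 ≤ m ∧ 1 ≤ n ∧ 0 ≤ l ∧ 1 ≤ m * n - l ^ 2 ∧
        ((n : ℚ) * t₁ ^ 2 + (m : ℚ) * t₂ ^ 2 - 2 * l * t₁ * t₂) / ((m : ℚ) * n - (l : ℚ) ^ 2)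
          = ν ∧ m * n - l ^ 2 = d} ∧
    {x : ℤ × ℤ × ℤ | 1 ≤ x.1 ∧ 1 ≤ x.2.1 ∧ 0 ≤ x.2.2 ∧ 1 ≤ x.1 * x.2.1 - x.2.2 ^ 2 ∧
        ((x.2.1 : ℚ) * t₁ ^ 2 + (x.1 : ℚ) * t₂ ^ 2 - 2 * x.2.2 * t₁ * t₂) /
          ((x.1 : ℚ) * x.2.1 - (x.2.2 : ℚ) ^ 2) = ν}.Infinite := by
  have unbounded (N : ℤ) (hN : 1 ≤ N) : ∃ m n l : ℤ, 1 ≤ m ∧ 1 ≤ n ∧ 0 ≤ l ∧ N ≤ m * n - l ^ 2 ∧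
      ((n : ℚ) * t₁ ^ 2 + (m : ℚ) * t₂ ^ 2 - 2 * l * t₁ * t₂) / ((m : ℚ) * n - (l : ℚ) ^ 2)
        = ν := by
    obtain ⟨m, n, l, hm, hn, hl, hd, h⟩ := exists_int_form_of_filling t₁ t₂ ν.num ν.den N ht₁ ht₂ ht
      (Rat.num_pos.2 hν) (by exact_mod_cast ν.den_pos) hN
    refine ⟨m, n, l, hm, hn, hl, hd, ?_⟩
    have hd0 : (0 : ℚ) < (m : ℚ) * n - (l : ℚ) ^ 2 := by
      exact_mod_cast hN.trans hd
    have hden : (ν.den : ℚ) ≠ 0 := by exact_mod_cast ν.den_nz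
    have hQ : (ν.den : ℚ) * (n * t₁ ^ 2 + m * t₂ ^ 2 - 2 * l * t₁ * t₂) =
        ν.num * (m * n - l ^ 2) := by exact_mod_cast h
    rw [← Rat.mul_den_eq_num] at hQ
    rw [div_eq_iff hd0.ne']
    exact mul_left_cancel₀ hden (by linear_combination hQ)
  have not_bdd : ¬ BddAbove {d : ℤ | ∃ m n l : ℤ, 1 ≤ m ∧ 1 ≤ n ∧ 0 ≤ l ∧ 1 ≤ m * n - l ^ 2 ∧
      ((n : ℚ) * t₁ ^ 2 + (m : ℚ) * t₂ ^ 2 - 2 * l * t₁ * t₂) / ((m : ℚ) * n - (l : ℚ) ^ 2)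
        = ν ∧ m * n - l ^ 2 = d} := by
    rintro ⟨B, hB⟩
    obtain ⟨m, n, l, hm, hn, hl, hd, h⟩ := unbounded (max 1 (B + 1)) (le_max_left _ _)
    have := hB ⟨m, n, l, hm, hn, hl, (le_max_left _ _).trans hd, h, rfl⟩
    have := (le_max_right 1 (B + 1)).trans hd
    omega
  refine ⟨fun C _ => ?_, not_bdd, fun hfin => not_bdd ?_⟩
  · obtain ⟨m, n, l, hm, hn, hl, hd, h⟩ := unbounded (max 1 (⌊C⌋ + 1)) (le_max_left _ _)
    refine ⟨m, n, l, hm, hn, hl, ?_, h⟩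
    exact Int.floor_lt.1 (Int.lt_of_add_one_le ((le_max_right _ _).trans hd))
  · refine (hfin.image fun x => x.1 * x.2.1 - x.2.2 ^ 2).bddAbove.mono ?_
    rintro d ⟨m, n, l, hm, hn, hl, hd, h, rfl⟩
    exact ⟨(m, n, l), ⟨hm, hn, hl, hd, h⟩, rfl⟩
end

section
/- Let p, q be coprime positive integers and let m be a positive integer with p·m > q. Setting l = p·m − q and n = p·(p·m − q), one has m·n − l² = q·(p·m − q) ≥ 1 and n/(m·n − l²) = p/q. In particular, since q·(p·m − q) can be made arbitrarily large by taking m large, the set sol_{p/q,1,0} of determinants of solutions for the charge vector (1,0) is unbounded. -/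
theorem halperin_det_eq {R : Type*} [CommRing R] (p q m : R) :
    m * (p * (p * m - q)) - (p * m - q) ^ 2 = q * (p * m - q) := by
  ring

theorem halperin_det_pos {p q m : ℤ} (hq : 1 ≤ q) (hmq : q < p * m) :
    1 ≤ q * (p * m - q) :=
  one_le_mul_of_one_le_of_one_le hq (by linarith)

theorem halperin_filling_eq {p q m : ℤ} (hmq : q < p * m) :
    ((p * (p * m - q) : ℤ) : ℚ) /
      ((m : ℚ) * (p * (p * m - q) : ℤ) - ((p * m - q : ℤ) : ℚ) ^ 2) = (p : ℚ) / q := by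
  have hl : (p * m - q : ℚ) ≠ 0 := by
    exact_mod_cast (sub_pos.mpr hmq).ne'
  push_cast
  rw [halperin_det_eq, mul_div_mul_right _ _ hl]

/-- For coprime positive integers `p, q` and `m ≥ 1` with `p*m > q`, taking `l = p*m - q` and
`n = p*(p*m - q)` gives `m*n - l² = q*(p*m - q) ≥ 1` and filling fraction `p/q`; moreover the
determinant set `sol_{p/q,1,0}` for charge vector `(1,0)` is unbounded. -/
theorem halperin_charge_one_zero (p q : ℤ) (hp : 1 ≤ p) (hq : 1 ≤ q) (hpq : IsCoprime p q)
    (m : ℤ) (hm : 1 ≤ m) (hmq : q < p * m) :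
    (m * (p * (p * m - q)) - (p * m - q) ^ 2 = q * (p * m - q) ∧
      1 ≤ q * (p * m - q) ∧
      ((p * (p * m - q) : ℤ) : ℚ) /
          ((m : ℚ) * (p * (p * m - q) : ℤ) - ((p * m - q : ℤ) : ℚ) ^ 2) = (p : ℚ) / q) ∧
    ¬ BddAbove {d : ℤ | ∃ m' n' l' : ℤ, 1 ≤ m' ∧ 1 ≤ n' ∧ 0 ≤ l' ∧ 1 ≤ m' * n' - l' ^ 2 ∧
        (n' : ℚ) / ((m' : ℚ) * n' - (l' : ℚ) ^ 2) = (p : ℚ) / q ∧ m' * n' - l' ^ 2 = d} := by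
  refine ⟨⟨halperin_det_eq p q m, halperin_det_pos hq hmq, halperin_filling_eq hmq⟩, ?_⟩
  rintro ⟨B, hB⟩
  have hk : 1 ≤ |B| + q + 1 := by linarith [abs_nonneg B]
  have hl : |B| + 1 ≤ p * (|B| + q + 1) - q := by nlinarith
  have hkq : q < p * (|B| + q + 1) := by linarith [abs_nonneg B]
  have hd := halperin_det_pos hq hkq
  have hle : q * (p * (|B| + q + 1) - q) ≤ B :=
    hB ⟨|B| + q + 1, p * (p * (|B| + q + 1) - q), p * (|B| + q + 1) - q, hk,
      one_le_mul_of_one_le_of_one_le hp (by linarith), by linarith,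
      by rwa [halperin_det_eq], halperin_filling_eq hkq, halperin_det_eq _ _ _⟩
  nlinarith [le_abs_self B, abs_nonneg B]
end

section
/- For every positive rational number ν there exist integers m ≥ 1, n ≥ 1, l ≥ 0 with m·n − l² ≥ 1 such that (m + n − 2·l)/(m·n − l²) = ν. Equivalently, A_{1,1} equals the set of all positive rationals. -/
/-- For every positive rational `ν` there exist integers `m ≥ 1`, `n ≥ 1`, `l ≥ 0` with
`m*n - l² ≥ 1` such that `(m + n - 2*l)/(m*n - l²) = ν`; i.e. `A_{1,1} = ℚ_{>0}`. -/
theorem halperin_one_one_any_filling (ν : ℚ) (hν : 0 < ν) :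
    ∃ m n l : ℤ, 1 ≤ m ∧ 1 ≤ n ∧ 0 ≤ l ∧ 1 ≤ m * n - l ^ 2 ∧
      ((m : ℚ) + n - 2 * l) / ((m : ℚ) * n - (l : ℚ) ^ 2) = ν := by
  obtain ⟨p, q, hp, hq, rfl⟩ : ∃ p q : ℤ, 0 < p ∧ 0 < q ∧ (p : ℚ) / q = ν :=
    ⟨ν.num, ν.den, Rat.num_pos.mpr hν, by exact_mod_cast ν.den_pos, by
      exact_mod_cast Rat.num_div_den ν⟩
  -- With `k = p * N - q` and `N = q + 1`, numerator and denominator become `k * p` and `k * q`.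
  obtain ⟨k, hk⟩ : ∃ k : ℤ, k = p * (q + 1) - q := ⟨_, rfl⟩
  have hk0 : 0 < k := by nlinarith
  have hden : (q + 1) * (q + 1 + k * (p + 2)) - (q + 1 + k) ^ 2 = k * q := by
    rw [hk]; ring
  have hkp : 0 < k * (p + 2) := by positivity
  have hkq : 0 < k * q := by positivity
  refine ⟨q + 1, q + 1 + k * (p + 2), q + 1 + k, by linarith, by linarith, by linarith,
    by linarith, ?_⟩
  have hdenQ : ((q + 1 : ℤ) : ℚ) * ((q + 1 + k * (p + 2) : ℤ) : ℚ)
      - ((q + 1 + k : ℤ) : ℚ) ^ 2 = k * q := by exact_mod_cast hden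
  have hkQ : (k : ℚ) ≠ 0 := by exact_mod_cast hk0.ne'
  rw [hdenQ, ← mul_div_mul_left (p : ℚ) q hkQ]
  push_cast
  ring
end

section
/- For every positive rational number ν and every real C > 0 there exist integers m ≥ 1, n ≥ 1, l ≥ 0 with m·n − l² > C and (m + n − 2·l)/(m·n − l²) = ν; hence the set sol_{ν,1,1} of determinants m·n − l² of solutions producing ν for the charge vector (1,1) is unbounded. -/
/-- An infinite family of solutions for the filling fraction `p / q`, with determinant
`u * q * k²`, where `u = p * (q + 1) - q`. -/
theorem exists_solution_family (p q k : ℤ) (hp : 1 ≤ p) (hq : 1 ≤ q) (hk : 1 ≤ k) :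
    ∃ m n l : ℤ, 1 ≤ m ∧ 1 ≤ n ∧ 0 ≤ l ∧ k ≤ m * n - l ^ 2 ∧
      (m + n - 2 * l) * q = p * (m * n - l ^ 2) := by
  obtain ⟨u, hu⟩ : ∃ u, u = p * (q + 1) - q := ⟨_, rfl⟩
  have hu1 : 1 ≤ u := by nlinarith
  have huk : 1 ≤ u * k := one_le_mul_of_one_le_of_one_le hu1 hk
  have hpuk : 1 ≤ p * (u * k) * k :=
    one_le_mul_of_one_le_of_one_le (one_le_mul_of_one_le_of_one_le hp huk) hk
  have hdet : (q + 1) * (q + 1 + 2 * (u * k) + p * (u * k) * k) - (q + 1 + u * k) ^ 2 =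
      u * q * k * k := by
    linear_combination -u * k ^ 2 * hu
  refine ⟨q + 1, q + 1 + 2 * (u * k) + p * (u * k) * k, q + 1 + u * k,
    by linarith, by linarith, by linarith, ?_, ?_⟩
  · rw [hdet]
    exact le_mul_of_one_le_left (by linarith) (one_le_mul_of_one_le_of_one_le
      (one_le_mul_of_one_le_of_one_le hu1 hq) hk)
  · rw [hdet]
    ring

/-- For every positive rational `ν` and every real `C > 0` there is a solution for the charge
vector `(1,1)` with determinant `m*n - l² > C`; hence `sol_{ν,1,1}` is unbounded. -/
theorem halperin_one_one_unbounded (ν : ℚ) (hν : 0 < ν) :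
    (∀ C : ℝ, 0 < C → ∃ m n l : ℤ, 1 ≤ m ∧ 1 ≤ n ∧ 0 ≤ l ∧ ((m * n - l ^ 2 : ℤ) : ℝ) > C ∧
        ((m : ℚ) + n - 2 * l) / ((m : ℚ) * n - (l : ℚ) ^ 2) = ν) ∧
    ¬ BddAbove {d : ℤ | ∃ m n l : ℤ, 1 ≤ m ∧ 1 ≤ n ∧ 0 ≤ l ∧ 1 ≤ m * n - l ^ 2 ∧
        ((m : ℚ) + n - 2 * l) / ((m : ℚ) * n - (l : ℚ) ^ 2) = ν ∧ m * n - l ^ 2 = d} := by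
  have key : ∀ C : ℝ, ∃ m n l : ℤ, 1 ≤ m ∧ 1 ≤ n ∧ 0 ≤ l ∧ 1 ≤ m * n - l ^ 2 ∧
      ((m * n - l ^ 2 : ℤ) : ℝ) > C ∧
      ((m : ℚ) + n - 2 * l) / ((m : ℚ) * n - (l : ℚ) ^ 2) = ν := by
    intro C
    obtain ⟨N, hN⟩ := exists_nat_gt C
    obtain ⟨m, n, l, hm, hn, hl, hd, he⟩ := exists_solution_family ν.num ν.den (N + 1)
      (Rat.num_pos.mpr hν) (by exact_mod_cast ν.den_pos) (by omega)
    have hd1 : 1 ≤ m * n - l ^ 2 := by omega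
    refine ⟨m, n, l, hm, hn, hl, hd1, ?_, ?_⟩
    · have h : ((N + 1 : ℤ) : ℝ) ≤ ((m * n - l ^ 2 : ℤ) : ℝ) := Int.cast_le.mpr hd
      push_cast at h ⊢
      linarith
    · have hD : (m : ℚ) * n - (l : ℚ) ^ 2 ≠ 0 := by
        have h : m * n - l ^ 2 ≠ 0 := by omega
        exact_mod_cast h
      have hq : (ν.den : ℚ) ≠ 0 := by exact_mod_cast ν.den_ne_zero
      have he' : ((m : ℚ) + n - 2 * l) * ν.den = ν.num * ((m : ℚ) * n - (l : ℚ) ^ 2) := by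
        exact_mod_cast he
      rw [← Rat.num_div_den ν, div_eq_div_iff hD hq]
      exact he'
  refine ⟨fun C _ => ?_, ?_⟩
  · obtain ⟨m, n, l, hm, hn, hl, -, hC, hf⟩ := key C
    exact ⟨m, n, l, hm, hn, hl, hC, hf⟩
  · rintro ⟨B, hB⟩
    obtain ⟨m, n, l, hm, hn, hl, hd, hC, hf⟩ := key B
    have h : m * n - l ^ 2 ≤ B := hB ⟨m, n, l, hm, hn, hl, hd, hf, rfl⟩
    exact absurd (Int.cast_lt.mp hC) h.not_gt
end

section
/- For every integer l ≥ 0 there exists a rational number ν with 0 < ν < 1 such that no integers m ≥ 1, n ≥ 1 satisfy m·n − l² ≥ 1 and (m + n − 2·l)/(m·n − l²) = ν. -/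
/-- The only factorization of `49` into two integers congruent to `3` modulo `5` is
`(-7) * (-7)`. -/
lemma eq_neg_two_of_mul_eq_forty_nine {j k : ℤ} (h : (5 * j + 3) * (5 * k + 3) = 49) :
    j = -2 ∧ k = -2 := by
  have hdvd : 5 * j + 3 ∣ 49 := ⟨_, h.symm⟩
  have hle : 5 * j + 3 ≤ 49 := Int.le_of_dvd (by norm_num) hdvd
  have hge : -(5 * j + 3) ≤ 49 := Int.le_of_dvd (by norm_num) (neg_dvd.mpr hdvd)
  have hlo : -10 ≤ j := by omega
  have hhi : j ≤ 9 := by omega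
  clear hdvd hle hge
  interval_cases j <;> omega

/-- For every integer `l ≥ 0` there is a rational `0 < ν < 1` which is not a filling fraction
`(m + n - 2*l)/(m*n - l²)` for any integers `m ≥ 1`, `n ≥ 1` with `m*n - l² ≥ 1`. -/
theorem halperin_one_one_fixed_l_missing_fraction (l : ℤ) (hl : 0 ≤ l) :
    ∃ ν : ℚ, 0 < ν ∧ ν < 1 ∧ ∀ m n : ℤ, 1 ≤ m → 1 ≤ n → 1 ≤ m * n - l ^ 2 →
      ((m : ℚ) + n - 2 * l) / ((m : ℚ) * n - (l : ℚ) ^ 2) ≠ ν := by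
  have hlq : (0 : ℚ) ≤ l := by exact_mod_cast hl
  have hb : (0 : ℚ) < 7 + 5 * l := by positivity
  refine ⟨5 / (7 + 5 * l), by positivity, by rw [div_lt_one hb]; linarith, ?_⟩
  intro m n _ _ hpos heq
  have hd : (0 : ℚ) < (m : ℚ) * n - (l : ℚ) ^ 2 := by
    exact_mod_cast (by omega : 0 < m * n - l ^ 2)
  rw [div_eq_div_iff hd.ne' hb.ne'] at heq
  have hz : (m + n - 2 * l) * (7 + 5 * l) = 5 * (m * n - l ^ 2) := by exact_mod_cast heq
  have hfac : (5 * (m - l - 2) + 3) * (5 * (n - l - 2) + 3) = 49 := by linear_combination -5 * hz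
  obtain ⟨hm, hn⟩ := eq_neg_two_of_mul_eq_forty_nine hfac
  obtain rfl : m = l := by omega
  obtain rfl : n = m := by omega
  nlinarith
end

section
/- Let t₁ ≥ 1 and t₂ ≥ 0 be integers, let p ≥ 2 be an integer and β ≥ 1 an integer. Set m = t₁², l = (p−1)·t₁·β + t₁·t₂, and n = (p−1)·p·β² + 2·(p−1)·t₂·β + t₂². Then m·n − l² = β²·(p−1)·t₁² ≥ 1 and (n·t₁² + m·t₂² − 2·l·t₁·t₂)/(m·n − l²) = p. -/
/-- For integers `t₁ ≥ 1`, `t₂ ≥ 0`, `p ≥ 2`, `β ≥ 1`, the K-matrix with entries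
`m = t₁²`, `l = (p-1)·t₁·β + t₁·t₂`, `n = (p-1)·p·β² + 2·(p-1)·t₂·β + t₂²` has determinant
`β²·(p-1)·t₁² ≥ 1` and produces filling fraction `p`. -/
theorem halperin_integer_filling_construction (t₁ t₂ p β : ℤ)
    (ht₁ : 1 ≤ t₁) (ht₂ : 0 ≤ t₂) (hp : 2 ≤ p) (hβ : 1 ≤ β) :
    t₁ ^ 2 * ((p - 1) * p * β ^ 2 + 2 * (p - 1) * t₂ * β + t₂ ^ 2)
        - ((p - 1) * t₁ * β + t₁ * t₂) ^ 2 = β ^ 2 * (p - 1) * t₁ ^ 2 ∧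
    1 ≤ β ^ 2 * (p - 1) * t₁ ^ 2 ∧
    (((p - 1) * p * β ^ 2 + 2 * (p - 1) * t₂ * β + t₂ ^ 2 : ℤ) * (t₁ : ℚ) ^ 2
        + ((t₁ ^ 2 : ℤ) : ℚ) * t₂ ^ 2
        - 2 * (((p - 1) * t₁ * β + t₁ * t₂ : ℤ) : ℚ) * t₁ * t₂) /
      (((t₁ ^ 2 : ℤ) : ℚ) * (((p - 1) * p * β ^ 2 + 2 * (p - 1) * t₂ * β + t₂ ^ 2 : ℤ) : ℚ)
        - (((p - 1) * t₁ * β + t₁ * t₂ : ℤ) : ℚ) ^ 2) = (p : ℚ) := by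
  have hdet : 1 ≤ β ^ 2 * (p - 1) * t₁ ^ 2 := by
    have hβ' : 0 < β := by lia
    have ht₁' : 0 < t₁ := by lia
    have hp' : 0 < p - 1 := by lia
    have : 0 < β ^ 2 * (p - 1) * t₁ ^ 2 := by positivity
    lia
  refine ⟨by ring, hdet, ?_⟩
  have hden : (β : ℚ) ^ 2 * (p - 1) * t₁ ^ 2 ≠ 0 := by
    exact_mod_cast (by lia : β ^ 2 * (p - 1) * t₁ ^ 2 ≠ 0)
  push_cast
  rw [div_eq_iff]
  · ring
  · convert hden using 1
    ring
end

section
/- Let t₁, t₂ be nonnegative integers, not both zero, and let S be any finite set of nonnegative integers. Then the union ⋃_{l₀ ∈ S} A_{t₁,t₂}^{l₀} is a proper subset of the positive rationals: there exists a positive rational ν such that for every l₀ ∈ S, ν is not of the form (n·t₁² + m·t₂² − 2·l₀·t₁·t₂)/(m·n − l₀²) with integers m ≥ 1, n ≥ 1 and m·n − l₀² ≥ 1. -/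
/-- A filling fraction with off-diagonal entry `l ≥ 0` is at most `(l² + 1)(t₁² + t₂²)`. -/
theorem fillingFraction_le {t₁ t₂ l m n : ℤ} (ht₁ : 0 ≤ t₁) (ht₂ : 0 ≤ t₂) (hl : 0 ≤ l)
    (hm : 1 ≤ m) (hn : 1 ≤ n) (hD : 1 ≤ m * n - l ^ 2) :
    ((n : ℚ) * t₁ ^ 2 + (m : ℚ) * t₂ ^ 2 - 2 * l * t₁ * t₂) / ((m : ℚ) * n - (l : ℚ) ^ 2) ≤
      ((l : ℚ) ^ 2 + 1) * (t₁ ^ 2 + t₂ ^ 2) := by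
  have hmn : m * n ≤ (l ^ 2 + 1) * (m * n - l ^ 2) := by
    nlinarith [mul_nonneg (sq_nonneg l) (sub_nonneg.2 hD)]
  have hn' : n ≤ (l ^ 2 + 1) * (m * n - l ^ 2) := by nlinarith
  have hm' : m ≤ (l ^ 2 + 1) * (m * n - l ^ 2) := by nlinarith
  have hcross : 0 ≤ l * t₁ * t₂ := by positivity
  have hnum : n * t₁ ^ 2 + m * t₂ ^ 2 - 2 * l * t₁ * t₂ ≤
      (l ^ 2 + 1) * (t₁ ^ 2 + t₂ ^ 2) * (m * n - l ^ 2) := by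
    linarith [mul_le_mul_of_nonneg_right hn' (sq_nonneg t₁),
      mul_le_mul_of_nonneg_right hm' (sq_nonneg t₂)]
  have hpos : (0 : ℚ) < (m : ℚ) * n - (l : ℚ) ^ 2 := by
    exact_mod_cast zero_lt_one.trans_le hD
  rw [div_le_iff₀ hpos]
  exact_mod_cast hnum

/-- For any finite set `S` of nonnegative integers, the union `⋃_{l₀ ∈ S} A_{t₁,t₂}^{l₀}`
misses some positive rational. -/
theorem halperin_finite_l_proper_subset (t₁ t₂ : ℤ) (ht₁ : 0 ≤ t₁) (ht₂ : 0 ≤ t₂)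
    (ht : ¬ (t₁ = 0 ∧ t₂ = 0)) (S : Finset ℤ) (hS : ∀ l₀ ∈ S, 0 ≤ l₀) :
    ∃ ν : ℚ, 0 < ν ∧ ∀ l₀ ∈ S, ¬ ∃ m n : ℤ, 1 ≤ m ∧ 1 ≤ n ∧ 1 ≤ m * n - l₀ ^ 2 ∧
      ((n : ℚ) * t₁ ^ 2 + (m : ℚ) * t₂ ^ 2 - 2 * l₀ * t₁ * t₂) /
        ((m : ℚ) * n - (l₀ : ℚ) ^ 2) = ν := by
  have hnonneg : ∀ l ∈ S, (0 : ℚ) ≤ ((l : ℚ) ^ 2 + 1) * (t₁ ^ 2 + t₂ ^ 2) :=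
    fun l _ => by positivity
  refine ⟨(∑ l ∈ S, ((l : ℚ) ^ 2 + 1) * (t₁ ^ 2 + t₂ ^ 2)) + 1,
    add_pos_of_nonneg_of_pos (Finset.sum_nonneg hnonneg) one_pos, ?_⟩
  rintro l hl ⟨m, n, hm, hn, hD, h⟩
  have hle := fillingFraction_le ht₁ ht₂ (hS l hl) hm hn hD
  have hsum := Finset.single_le_sum hnonneg hl
  linarith
end

section
/- For any nonnegative integers t₁, t₂ not both zero and any positive rational ν, there exist integers m ≥ 1, n ≥ 1, l ≥ 0 with m and n both even, m·n − l² ≥ 1, and (n·t₁² + m·t₂² − 2·l·t₁·t₂)/(m·n − l²) = ν; moreover for every real C > 0 such a solution exists with m·n − l² > C. Equivalently, B_{t₁,t₂} equals the set of all positive rationals and every positive rational has infinitely many bosonic solutions. -/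
/-- A coprime pair of nonnegative integers is the first column of a matrix in `GL₂(ℤ)` with
nonnegative entries. -/
theorem exists_nonneg_det_sq_eq_one {a c : ℤ} (ha : 0 ≤ a) (hc : 0 ≤ c) (hac : IsCoprime a c) :
    ∃ b d : ℤ, 0 ≤ b ∧ 0 ≤ d ∧ (a * d - b * c) ^ 2 = 1 := by
  rcases ha.eq_or_lt with rfl | ha
  · refine ⟨1, 0, by norm_num, le_rfl, ?_⟩
    have hu : IsUnit c := isCoprime_zero_left.mp hac
    simpa using Int.isUnit_sq hu
  rcases hc.eq_or_lt with rfl | hc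
  · refine ⟨0, 1, le_rfl, by norm_num, ?_⟩
    have hu : IsUnit a := isCoprime_zero_right.mp hac
    simpa using Int.isUnit_sq hu
  obtain ⟨u, v, huv⟩ := hac
  refine ⟨(|u| + |v|) * a - v, u + (|u| + |v|) * c, ?_, ?_, ?_⟩
  · nlinarith [abs_nonneg u, abs_nonneg v, le_abs_self v]
  · nlinarith [abs_nonneg u, abs_nonneg v, neg_abs_le u]
  · linear_combination (u * a + v * c + 1) * huv

/-- The congruence `K = U K' Uᵀ`, where `K'` has entries `m'`, `l'`, `n'` and `U` has rows `(a, b)`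
and `(c, d)`, turns an even form `K'` with charge vector `(g, 0)` into an even form `K` with charge
vector `(g a, g c)`. -/
theorem exists_even_form_of_det_sq_eq_one {a b c d m' n' l' : ℤ} (g : ℤ)
    (ha : 0 ≤ a) (hb : 0 ≤ b) (hc : 0 ≤ c) (hd : 0 ≤ d) (hU : (a * d - b * c) ^ 2 = 1)
    (hm' : 0 ≤ m') (hn' : 0 ≤ n') (hl' : 0 ≤ l') (hm'_even : Even m') (hn'_even : Even n')
    (hdet : 0 < m' * n' - l' ^ 2) :
    ∃ m n l : ℤ, 1 ≤ m ∧ 1 ≤ n ∧ 0 ≤ l ∧ Even m ∧ Even n ∧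
      m * n - l ^ 2 = m' * n' - l' ^ 2 ∧
      n * (g * a) ^ 2 + m * (g * c) ^ 2 - 2 * l * (g * a) * (g * c) = n' * g ^ 2 := by
  obtain ⟨m, hm⟩ : ∃ m, m = a ^ 2 * m' + 2 * (a * b * l') + b ^ 2 * n' := ⟨_, rfl⟩
  obtain ⟨n, hn⟩ : ∃ n, n = c ^ 2 * m' + 2 * (c * d * l') + d ^ 2 * n' := ⟨_, rfl⟩
  obtain ⟨l, hl⟩ : ∃ l, l = a * c * m' + (a * d + b * c) * l' + b * d * n' := ⟨_, rfl⟩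
  have hm0 : 0 ≤ m := by rw [hm]; positivity
  have hn0 : 0 ≤ n := by rw [hn]; positivity
  have hl0 : 0 ≤ l := by rw [hl]; positivity
  have hK : m * n - l ^ 2 = m' * n' - l' ^ 2 := by
    rw [hm, hn, hl]
    linear_combination (m' * n' - l' ^ 2) * hU
  have hmn : 0 < m * n := by linarith [sq_nonneg l]
  refine ⟨m, n, l, ?_, ?_, hl0, ?_, ?_, hK, ?_⟩
  · exact pos_of_mul_pos_left hmn hn0
  · exact pos_of_mul_pos_right hmn hm0
  · rw [hm]
    exact ((hm'_even.mul_left _).add (even_two_mul _)).add (hn'_even.mul_left _)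
  · rw [hn]
    exact ((hm'_even.mul_left _).add (even_two_mul _)).add (hn'_even.mul_left _)
  · rw [hm, hn, hl]
    linear_combination (n' * g ^ 2) * hU


/-- For any nonnegative `t₁, t₂` not both zero and any positive rational `ν`, there is a
bosonic solution (`m`, `n` both even) producing `ν`; moreover for every real `C > 0` such a
solution exists with determinant `m*n - l² > C`. Hence `B_{t₁,t₂} = ℚ_{>0}` and every
positive rational has infinitely many bosonic K-matrices. -/
theorem halperin_bosonic_any_filling (t₁ t₂ : ℤ) (ht₁ : 0 ≤ t₁) (ht₂ : 0 ≤ t₂)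
    (ht : ¬ (t₁ = 0 ∧ t₂ = 0)) (ν : ℚ) (hν : 0 < ν) :
    (∃ m n l : ℤ, 1 ≤ m ∧ 1 ≤ n ∧ 0 ≤ l ∧ Even m ∧ Even n ∧ 1 ≤ m * n - l ^ 2 ∧
        ((n : ℚ) * t₁ ^ 2 + (m : ℚ) * t₂ ^ 2 - 2 * l * t₁ * t₂) /
          ((m : ℚ) * n - (l : ℚ) ^ 2) = ν) ∧
    ∀ C : ℝ, 0 < C → ∃ m n l : ℤ, 1 ≤ m ∧ 1 ≤ n ∧ 0 ≤ l ∧ Even m ∧ Even n ∧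
        ((m * n - l ^ 2 : ℤ) : ℝ) > C ∧
        ((n : ℚ) * t₁ ^ 2 + (m : ℚ) * t₂ ^ 2 - 2 * l * t₁ * t₂) /
          ((m : ℚ) * n - (l : ℚ) ^ 2) = ν := by
  suffices h : ∀ C : ℝ, 0 < C → ∃ m n l : ℤ, 1 ≤ m ∧ 1 ≤ n ∧ 0 ≤ l ∧ Even m ∧ Even n ∧
      ((m * n - l ^ 2 : ℤ) : ℝ) > C ∧
      ((n : ℚ) * t₁ ^ 2 + (m : ℚ) * t₂ ^ 2 - 2 * l * t₁ * t₂) /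
        ((m : ℚ) * n - (l : ℚ) ^ 2) = ν by
    refine ⟨?_, h⟩
    obtain ⟨m, n, l, hm, hn, hl, hm_even, hn_even, hdet, hfill⟩ := h 1 one_pos
    exact ⟨m, n, l, hm, hn, hl, hm_even, hn_even, by exact_mod_cast hdet.le, hfill⟩
  intro C hC
  have hgcd : 0 < t₁.gcd t₂ := Int.gcd_pos_iff.mpr (not_and_or.mp ht)
  obtain ⟨g, hg⟩ : ∃ g : ℤ, g = t₁.gcd t₂ := ⟨_, rfl⟩
  have hg0 : 0 < g := by rw [hg]; exact_mod_cast hgcd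
  obtain ⟨a, c, hac, h₁, h₂⟩ := Int.exists_gcd_one hgcd
  rw [← hg, mul_comm] at h₁ h₂
  have ha : 0 ≤ a := nonneg_of_mul_nonneg_right (h₁ ▸ ht₁) hg0
  have hc : 0 ≤ c := nonneg_of_mul_nonneg_right (h₂ ▸ ht₂) hg0
  obtain ⟨b, d, hb, hd, hU⟩ :=
    exists_nonneg_det_sq_eq_one ha hc (Int.isCoprime_iff_gcd_eq_one.mpr hac)
  obtain ⟨p, hp⟩ : ∃ p : ℤ, p = ν.num := ⟨_, rfl⟩
  obtain ⟨q, hq⟩ : ∃ q : ℤ, q = ν.den := ⟨_, rfl⟩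
  have hp0 : 0 < p := hp ▸ Rat.num_pos.mpr hν
  have hq0 : 0 < q := by rw [hq]; exact_mod_cast ν.den_pos
  have hν_eq : (p : ℚ) / q = ν := by rw [hp, hq]; exact_mod_cast ν.num_div_den
  obtain ⟨y, hy⟩ : ∃ y : ℤ, y = ⌈C⌉ + 1 := ⟨_, rfl⟩
  have hCy : C < y := by rw [hy]; push_cast; linarith [Int.le_ceil C]
  have hy0 : 0 < y := by exact_mod_cast hC.trans hCy
  obtain ⟨x, hx⟩ : ∃ x : ℤ, x = q * g ^ 2 * (2 * p - 1) := ⟨_, rfl⟩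
  have hx0 : 0 < x := by
    rw [hx]
    exact mul_pos (by positivity) (by linarith)
  have hdet : 2 * (q * g ^ 2) * (2 * (2 * p * x * y ^ 2)) - (2 * x * y) ^ 2 =
      4 * x * y ^ 2 * q * g ^ 2 := by
    linear_combination (-4 * x * y ^ 2) * hx
  have hy_le : y ≤ 4 * x * y ^ 2 * q * g ^ 2 := by
    have : 0 < 4 * x * y * q * g ^ 2 := by positivity
    nlinarith
  obtain ⟨m, n, l, hm, hn, hl, hm_even, hn_even, hK, hnum⟩ :=
    exists_even_form_of_det_sq_eq_one g ha hb hc hd hU (m' := 2 * (q * g ^ 2))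
      (n' := 2 * (2 * p * x * y ^ 2)) (l' := 2 * x * y) (by positivity) (by positivity)
      (by positivity) (even_two_mul _) (even_two_mul _) (by rw [hdet]; positivity)
  rw [hdet] at hK
  rw [← h₁, ← h₂] at hnum
  refine ⟨m, n, l, hm, hn, hl, hm_even, hn_even, ?_, ?_⟩
  · rw [hK]
    exact hCy.trans_le (by exact_mod_cast hy_le)
  · have hK' : (m : ℚ) * n - (l : ℚ) ^ 2 = 4 * x * y ^ 2 * q * g ^ 2 := by exact_mod_cast hK
    have hnum' : (n : ℚ) * t₁ ^ 2 + (m : ℚ) * t₂ ^ 2 - 2 * l * t₁ * t₂ =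
        2 * (2 * p * x * y ^ 2) * g ^ 2 := by exact_mod_cast hnum
    rw [hK', hnum', ← hν_eq]
    field_simp
    norm_num
end
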